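/- arXiv:2508.10139 — 5 statements merged into one kernel-verified Lean document; each statement's English description precedes it below -/
import Mathlib

section
/- Let α be a unit of S and let τ ∈ Aut(S) commute with σ. Then the map G_{τ,α} : R/Rf → R/Rh, ∑_{i=0}^{m-1} d_i t^i ↦ ∑_{i=0}^{m-1} τ(d_i) N_i^σ(α) t^i, is an isomorphism of algebras over the common fixed ring of σ and τ if and only if τ(a_i) = N_{m-i}^σ(σ^i(α))·b_i for all i ∈ {0, …, m−1}. -/
/-- `Nsig σ i β = ∏_{j=0}^{i-1} σ^j(β)`. -/
def Nsig {S : Type*} [CommRing S] (σ : S ≃+* S) (i : ℕ) (β : S) : S :=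
  ∏ j ∈ Finset.range i, (σ ^ j) β

/-- The coefficient vector of the monomial `c·t^k` in `S^m`. -/
def stdVec {S : Type*} [Ring S] (m k : ℕ) (c : S) : Fin m → S :=
  fun j => if (j : ℕ) = k then c else 0

/-- Left multiplication by `t`, followed by reduction modulo `f = t^m − ∑ a_i t^i`,
on coefficient vectors representing elements of the Petit algebra `S[t;σ]/S[t;σ]f`. -/
def tmul {S : Type*} [Ring S] (σ : S ≃+* S) {m : ℕ} (a : Fin m → S)
    (c : Fin m → S) : Fin m → S :=
  fun j =>
    (if _ : (j : ℕ) = 0 then 0 else σ (c ⟨(j : ℕ) - 1, by have := j.isLt; omega⟩)) +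
      σ (c ⟨m - 1, by have := j.isLt; omega⟩) * a j

/-- The multiplication of the Petit algebra `S[t;σ]/S[t;σ]f`, `f = t^m − ∑ a_i t^i`:
`g ∘ h` is the remainder of the skew-polynomial product `g·h` under right division by `f`. -/
def petitMul {S : Type*} [Ring S] (σ : S ≃+* S) {m : ℕ} (a : Fin m → S)
    (g h : Fin m → S) : Fin m → S :=
  fun j => ∑ i : Fin m, g i * (tmul σ a)^[(i : ℕ)] h j

/-- The map `G_{τ,α} : ∑ d_i t^i ↦ ∑ τ(d_i) N_i^σ(α) t^i` on coefficient vectors. -/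
def Gmap {S : Type*} [CommRing S] (σ τ : S ≃+* S) (α : S) {m : ℕ}
    (d : Fin m → S) : Fin m → S :=
  fun i => τ (d i) * Nsig σ (i : ℕ) α

/-- `G` is an isomorphism from the Petit algebra `S[t;σ]/S[t;σ](t^m − ∑ a_i t^i)` to the
Petit algebra `S[t;σ]/S[t;σ](t^m − ∑ b_i t^i)`: a bijective, additive, unital and
multiplicative map on coefficient vectors. -/
def IsPetitIso {S : Type*} [Ring S] (σ : S ≃+* S) {m : ℕ} (a b : Fin m → S)
    (G : (Fin m → S) → (Fin m → S)) : Prop :=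
  Function.Bijective G ∧ (∀ x y, G (x + y) = G x + G y) ∧
    G (stdVec m 0 1) = stdVec m 0 1 ∧
    (∀ x y, G (petitMul σ a x y) = petitMul σ b (G x) (G y))

lemma Nsig_succ {S : Type*} [CommRing S] (σ : S ≃+* S) (i : ℕ) (β : S) :
    Nsig σ (i + 1) β = β * σ (Nsig σ i β) := by
  simp only [Nsig, Finset.prod_range_succ', map_prod, pow_succ', RingAut.mul_apply]
  simp [mul_comm]

lemma Nsig_add {S : Type*} [CommRing S] (σ : S ≃+* S) (i k : ℕ) (β : S) :
    Nsig σ (i + k) β = Nsig σ i β * Nsig σ k ((σ ^ i) β) := by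
  simp only [Nsig, Finset.prod_range_add, ← RingAut.mul_apply, ← pow_add, add_comm]

lemma mul_map_Nsig_pred {S : Type*} [CommRing S] (σ : S ≃+* S) (β : S) {m : ℕ} (j : Fin m) :
    β * σ (Nsig σ (m - 1) β) = Nsig σ j β * Nsig σ (m - (j : ℕ)) ((σ ^ (j : ℕ)) β) := by
  have hj := j.isLt
  rw [← Nsig_succ, ← Nsig_add]
  congr 1
  omega

lemma isUnit_Nsig {S : Type*} [CommRing S] (σ : S ≃+* S) (i : ℕ) {β : S} (hβ : IsUnit β) :
    IsUnit (Nsig σ i β) := by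
  induction i with
  | zero => simp [Nsig]
  | succ i ih => rw [Nsig_succ]; exact hβ.mul (ih.map σ)

lemma Gmap_bijective {S : Type*} [CommRing S] (σ τ : S ≃+* S) {α : S} (hα : IsUnit α) (m : ℕ) :
    Function.Bijective (Gmap σ τ α : (Fin m → S) → Fin m → S) := by
  constructor
  · intro x y h
    funext i
    exact τ.injective ((isUnit_Nsig σ i hα).mul_left_injective (congrFun h i))
  · intro y
    choose u hu using fun i : Fin m => (isUnit_Nsig σ i hα).exists_left_inv
    refine ⟨fun i => τ.symm (y i * u i), funext fun i => ?_⟩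
    simp [Gmap, mul_assoc, hu]

lemma tmul_smul {S : Type*} [CommRing S] (σ : S ≃+* S) {m : ℕ} (a : Fin m → S) (s : S)
    (c : Fin m → S) : tmul σ a (s • c) = σ s • tmul σ a c := by
  funext j
  simp only [tmul, Pi.smul_apply, smul_eq_mul, map_mul]
  split_ifs <;> ring

/-- Left multiplication by a monomial of degree one. -/
lemma petitMul_stdVec_one {S : Type*} [CommRing S] (σ : S ≃+* S) {m : ℕ} (hm : 1 < m)
    (a : Fin m → S) (s : S) (y : Fin m → S) :
    petitMul σ a (stdVec m 1 s) y = s • tmul σ a y := by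
  funext j
  rw [petitMul, Finset.sum_eq_single ⟨1, hm⟩]
  · simp [stdVec]
  · intro i _ hi
    have : (i : ℕ) ≠ 1 := fun h => hi (Fin.ext h)
    simp [stdVec, this]
  · simp

lemma Gmap_stdVec {S : Type*} [CommRing S] (σ τ : S ≃+* S) (α : S) (m k : ℕ) (c : S) :
    Gmap σ τ α (stdVec m k c) = stdVec m k (τ c * Nsig σ k α) := by
  funext i
  by_cases h : (i : ℕ) = k <;> simp [Gmap, stdVec, h]

lemma tmul_stdVec_last {S : Type*} [CommRing S] (σ : S ≃+* S) {m : ℕ} (a : Fin m → S) (c : S) :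
    tmul σ a (stdVec m (m - 1) c) = fun j => σ c * a j := by
  funext j
  have hj := j.isLt
  by_cases h : (j : ℕ) = 0
  · simp [tmul, stdVec, h]
  · have : (j : ℕ) - 1 ≠ m - 1 := by omega
    simp [tmul, stdVec, h, this]

lemma Gmap_tmul {S : Type*} [CommRing S] {σ τ : S ≃+* S} (hστ : σ * τ = τ * σ) {α : S} {m : ℕ}
    {a b : Fin m → S}
    (hab : ∀ i : Fin m, τ (a i) = Nsig σ (m - (i : ℕ)) ((σ ^ (i : ℕ)) α) * b i) (c : Fin m → S) :
    Gmap σ τ α (tmul σ a c) = α • tmul σ b (Gmap σ τ α c) := by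
  have hcomm (s : S) : τ (σ s) = σ (τ s) := (DFunLike.congr_fun hστ s).symm
  funext j
  have hj := j.isLt
  have hN := mul_map_Nsig_pred σ α j
  have hlow (h : (j : ℕ) ≠ 0) : α * σ (Nsig σ ((j : ℕ) - 1) α) = Nsig σ j α := by
    rw [← Nsig_succ]
    congr 1
    omega
  simp only [Gmap, tmul, Pi.smul_apply, smul_eq_mul, map_add, map_mul, hab, hcomm]
  split_ifs with h
  · rw [map_zero]
    linear_combination -(σ (τ (c ⟨m - 1, by omega⟩)) * b j) * hN
  · rw [hcomm]
    linear_combination -(σ (τ (c ⟨m - 1, by omega⟩)) * b j) * hN -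
      σ (τ (c ⟨(j : ℕ) - 1, by omega⟩)) * hlow h

lemma Gmap_iterate_tmul {S : Type*} [CommRing S] {σ τ : S ≃+* S} {α : S} {m : ℕ}
    {a b : Fin m → S}
    (hG : ∀ c : Fin m → S, Gmap σ τ α (tmul σ a c) = α • tmul σ b (Gmap σ τ α c))
    (k : ℕ) (c : Fin m → S) :
    Gmap σ τ α ((tmul σ a)^[k] c) = Nsig σ k α • (tmul σ b)^[k] (Gmap σ τ α c) := by
  induction k with
  | zero => simp [Nsig]
  | succ k ih =>
    rw [Function.iterate_succ_apply', hG, ih, tmul_smul, smul_smul, ← Nsig_succ,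
      Function.iterate_succ_apply']

lemma Gmap_petitMul {S : Type*} [CommRing S] {σ τ : S ≃+* S} {α : S} {m : ℕ}
    {a b : Fin m → S}
    (hG : ∀ c : Fin m → S, Gmap σ τ α (tmul σ a c) = α • tmul σ b (Gmap σ τ α c))
    (x y : Fin m → S) :
    Gmap σ τ α (petitMul σ a x y) = petitMul σ b (Gmap σ τ α x) (Gmap σ τ α y) := by
  funext j
  have hterm (i : Fin m) : τ ((tmul σ a)^[(i : ℕ)] y j) * Nsig σ j α =
      Nsig σ i α * (tmul σ b)^[(i : ℕ)] (Gmap σ τ α y) j :=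
    congrFun (Gmap_iterate_tmul hG i y) j
  change τ (∑ i : Fin m, x i * (tmul σ a)^[(i : ℕ)] y j) * Nsig σ j α =
    ∑ i : Fin m, τ (x i) * Nsig σ i α * (tmul σ b)^[(i : ℕ)] (Gmap σ τ α y) j
  rw [map_sum, Finset.sum_mul]
  refine Finset.sum_congr rfl fun i _ => ?_
  rw [map_mul, mul_assoc, hterm, mul_assoc]

/-- **Theorem (isometries between Petit algebras).**  Let `S` be a commutative ring,
`σ` an automorphism of `S`, `f = t^m − ∑ a_i t^i` and `h = t^m − ∑ b_i t^i` monic of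
degree `m > 1` in `R = S[t;σ]`.  Let `α ∈ S^×` and let `τ ∈ Aut(S)` commute with `σ`.
Then `G_{τ,α} : R/Rf → R/Rh` is an isomorphism of algebras over the common fixed ring of
`σ` and `τ` if and only if `τ(a_i) = N_{m-i}^σ(σ^i(α))·b_i` for all `i ∈ {0,…,m−1}`. -/
theorem stmt0 {S : Type*} [CommRing S] (σ τ : S ≃+* S) (hστ : σ * τ = τ * σ)
    (α : S) (hα : IsUnit α) (m : ℕ) (hm : 1 < m) (a b : Fin m → S) :
    (IsPetitIso σ a b (Gmap σ τ α) ∧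
        ∀ s : S, σ s = s → τ s = s → ∀ x : Fin m → S,
          Gmap σ τ α (s • x) = s • Gmap σ τ α x) ↔
      ∀ i : Fin m, τ (a i) = Nsig σ (m - (i : ℕ)) ((σ ^ (i : ℕ)) α) * b i := by
  constructor
  · rintro ⟨⟨-, -, -, hmul⟩, -⟩ j
    have h := congrFun (hmul (stdVec m 1 1) (stdVec m (m - 1) 1)) j
    rw [Gmap_stdVec, Gmap_stdVec, petitMul_stdVec_one σ hm, petitMul_stdVec_one σ hm,
      tmul_stdVec_last, tmul_stdVec_last] at h
    have hN := mul_map_Nsig_pred σ α j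
    have h1 : Nsig σ 1 α = α := by simp [Nsig]
    simp only [Gmap, Pi.smul_apply, smul_eq_mul, map_one, one_mul, h1] at h
    apply (isUnit_Nsig σ j hα).mul_left_cancel
    linear_combination h + b j * hN
  · intro hab
    refine ⟨⟨Gmap_bijective σ τ hα m, fun x y => ?_, ?_, Gmap_petitMul (Gmap_tmul hστ hab)⟩,
      fun s _ hs x => ?_⟩
    · funext i
      simp [Gmap, add_mul]
    · simp [Gmap_stdVec, Nsig]
    · funext i
      simp [Gmap, hs, mul_assoc]
end

section
/- Suppose τ ∈ Aut(S) commutes with σ, α is a unit of S, and define f^τ(t) = t^m − ∑_{i=0}^{m-1} τ(a_i) t^i. Then G_{τ,α} : R/Rf → R/Rh is an algebra isomorphism if and only if G_{id,α} : R/Rf^τ → R/Rh is an algebra isomorphism. -/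
/-- Precomposing with an isomorphism of Petit algebras does not affect being an isomorphism. -/
theorem IsPetitIso.comp_right_iff {S : Type*} [Ring S] {σ : S ≃+* S} {m : ℕ}
    {a a' b : Fin m → S} {T : (Fin m → S) → (Fin m → S)} (hT : IsPetitIso σ a a' T)
    (G : (Fin m → S) → (Fin m → S)) :
    IsPetitIso σ a b (G ∘ T) ↔ IsPetitIso σ a' b G := by
  obtain ⟨hbij, hadd, hone, hmul⟩ := hT
  unfold IsPetitIso
  rw [Function.Bijective.of_comp_iff G hbij]
  simp only [Function.comp_apply, hone, ← hadd, ← hmul,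
    hbij.surjective.forall₂ (p := fun x y => G (x + y) = G x + G y),
    hbij.surjective.forall₂ (p := fun x y => G (petitMul σ a' x y) = petitMul σ b (G x) (G y))]

/-- A ring automorphism commuting with `σ`, applied coefficientwise, commutes with left
multiplication by `t`. -/
theorem tmul_map {S : Type*} [Ring S] {σ τ : S ≃+* S} (hστ : Commute σ τ) {m : ℕ}
    (a c : Fin m → S) :
    tmul σ (fun i => τ (a i)) (fun i => τ (c i)) = fun i => τ (tmul σ a c i) := by
  have hcomm (x : S) : σ (τ x) = τ (σ x) := DFunLike.congr_fun hστ.eq x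
  funext j
  by_cases hj : (j : ℕ) = 0 <;> simp [tmul, hj, hcomm]

/-- A ring automorphism `τ` commuting with `σ`, applied coefficientwise, is an isomorphism from the
Petit algebra of `f` to that of `f^τ`. -/
theorem isPetitIso_map {S : Type*} [Ring S] {σ τ : S ≃+* S} (hστ : Commute σ τ) {m : ℕ}
    (a : Fin m → S) :
    IsPetitIso σ a (fun i => τ (a i)) (fun d i => τ (d i)) := by
  refine ⟨(Equiv.piCongrRight fun _ : Fin m => τ.toEquiv).bijective, fun x y => ?_, ?_,
    fun x y => ?_⟩
  · funext i
    simp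
  · funext i
    simp [stdVec, apply_ite τ]
  · have hiter (k : ℕ) : (tmul σ fun i => τ (a i))^[k] (fun i => τ (y i)) =
        fun i => τ ((tmul σ a)^[k] y i) :=
      (Function.Semiconj.iterate_right (f := fun (d : Fin m → S) i => τ (d i))
        (fun c => (tmul_map hστ a c).symm) k y).symm
    funext j
    simp [petitMul, hiter]

/-- **Theorem.**  Suppose `τ ∈ Aut(S)` commutes with `σ`, `α ∈ S^×`, and define
`f^τ = t^m − ∑ τ(a_i) t^i`.  Then `G_{τ,α} : R/Rf → R/Rh` is an isomorphism if and only
if `G_{id,α} : R/Rf^τ → R/Rh` is an isomorphism. -/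
theorem stmt3 {S : Type*} [CommRing S] (σ τ : S ≃+* S) (hστ : σ * τ = τ * σ)
    (α : S) (hα : IsUnit α) (m : ℕ) (hm : 1 < m) (a b : Fin m → S) :
    IsPetitIso σ a b (Gmap σ τ α) ↔
      IsPetitIso σ (fun i => τ (a i)) b (Gmap σ (RingEquiv.refl S) α) := by
  exact (isPetitIso_map hστ a).comp_right_iff (Gmap σ (RingEquiv.refl S) α)
end

section
/- Suppose σ ≠ id, τ ∈ Aut(S) commutes with σ, k ∈ ℕ with 1 < k < m−1, and α is a unit of S. If the map G_{τ,α,k} (defined by G(c) = τ(c) for c ∈ S and G(t) = α t^k) is an isomorphism between R/Rf and R/Rh, then σ^k = σ, i.e. k ≡ 1 (mod n), where n is the order of σ. -/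
/-- The map `G_{τ,α,k} : ∑ d_i t^i ↦ ∑ τ(d_i) (α t^k)^i mod_r h`, where
`h = t^m − ∑ b_i t^i`; one has `(α t^k)^i = N_i^{σ^k}(α) t^{k i}` in `S[t;σ]`. -/
def Gmapk {S : Type*} [CommRing S] (σ τ : S ≃+* S) (α : S) (k : ℕ) {m : ℕ}
    (b : Fin m → S) (d : Fin m → S) : Fin m → S :=
  ∑ i : Fin m, (τ (d i) * Nsig (σ ^ k) (i : ℕ) α) • (tmul σ b)^[k * (i : ℕ)] (stdVec m 0 1)

theorem tmul_stdVec {S : Type*} [Ring S] (σ : S ≃+* S) {m : ℕ} (a : Fin m → S) (i : ℕ)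
    (hi : i + 1 < m) (c : S) : tmul σ a (stdVec m i c) = stdVec m (i + 1) (σ c) := by
  funext j
  have h1 : ¬ (m - 1 = i) := by omega
  simp only [tmul, stdVec, h1, if_false, map_zero, zero_mul, add_zero]
  by_cases hj : (j : ℕ) = 0
  · rw [dif_pos hj, if_neg (by omega)]
  · rw [dif_neg hj]
    by_cases hji : (j : ℕ) = i + 1
    · rw [if_pos (by omega), if_pos hji]
    · rw [if_neg (by omega), if_neg hji, map_zero]

theorem tmul_iterate_stdVec_zero {S : Type*} [Ring S] (σ : S ≃+* S) {m : ℕ} (a : Fin m → S)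
    (i : ℕ) (hi : i < m) (c : S) :
    (tmul σ a)^[i] (stdVec m 0 c) = stdVec m i ((σ ^ i) c) := by
  induction i with
  | zero => simp
  | succ i ih =>
    rw [Function.iterate_succ_apply', ih (by omega), tmul_stdVec σ a i hi, pow_succ']
    rfl

theorem petitMul_stdVec_stdVec_zero {S : Type*} [Ring S] (σ : S ≃+* S) {m : ℕ} (a : Fin m → S)
    (i : ℕ) (hi : i < m) (c d : S) :
    petitMul σ a (stdVec m i d) (stdVec m 0 c) = stdVec m i (d * (σ ^ i) c) := by
  funext j
  rw [petitMul, Finset.sum_eq_single (⟨i, hi⟩ : Fin m)]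
  · rw [tmul_iterate_stdVec_zero σ a i hi]
    simp [stdVec]
  · intro l _ hl
    have : (l : ℕ) ≠ i := fun h => hl (Fin.ext h)
    simp [stdVec, this]
  · simp

theorem Gmapk_stdVec {S : Type*} [CommRing S] (σ τ : S ≃+* S) (α : S) (k : ℕ) {m : ℕ}
    (b : Fin m → S) (i : ℕ) (hi : i < m) (hki : k * i < m) (d : S) :
    Gmapk σ τ α k b (stdVec m i d) = stdVec m (k * i) (τ d * Nsig (σ ^ k) i α) := by
  rw [Gmapk, Finset.sum_eq_single (⟨i, hi⟩ : Fin m)]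
  · rw [tmul_iterate_stdVec_zero σ b (k * i) hki]
    funext j
    simp [stdVec]
  · intro l _ hl
    have : (l : ℕ) ≠ i := fun h => hl (Fin.ext h)
    simp [stdVec, this]
  · simp

/-- **Lemma.**  Suppose `σ ≠ id`, `τ ∈ Aut(S)` commutes with `σ`, `1 < k < m − 1` and
`α ∈ S^×`.  If `G_{τ,α,k}` (given by `G(c) = τ(c)` for `c ∈ S` and `G(t) = α t^k`) is an
isomorphism from `R/Rf` to `R/Rh`, then `σ^k = σ`, i.e. `k ≡ 1 (mod n)` where `n` is the
order of `σ`. -/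
theorem stmt4 {S : Type*} [CommRing S] (σ τ : S ≃+* S)
    (hσ : σ ≠ RingEquiv.refl S) (hστ : σ * τ = τ * σ)
    (n : ℕ) (hn : 0 < n) (hord : orderOf σ = n)
    (m k : ℕ) (hm : 1 < m) (hk1 : 1 < k) (hk2 : k < m - 1)
    (α : S) (hα : IsUnit α) (a b : Fin m → S)
    (hiso : IsPetitIso σ a b (Gmapk σ τ α k b)) :
    σ ^ k = σ ∧ k ≡ 1 [MOD n] := by
  have key : σ ^ k = σ := by
    refine RingEquiv.ext fun x => ?_
    obtain ⟨c, rfl⟩ := τ.surjective x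
    have h := hiso.2.2.2 (stdVec m 1 1) (stdVec m 0 c)
    rw [petitMul_stdVec_stdVec_zero σ a 1 hm, Gmapk_stdVec σ τ α k b 1 hm (by omega),
      Gmapk_stdVec σ τ α k b 1 hm (by omega), Gmapk_stdVec σ τ α k b 0 (by omega) (by omega),
      mul_zero, mul_one, petitMul_stdVec_stdVec_zero σ b k (by omega)] at h
    have hk := congrFun h ⟨k, by omega⟩
    have hcomm : σ (τ c) = τ (σ c) := DFunLike.congr_fun hστ c
    simp only [stdVec, Nsig, if_true, Finset.prod_range_one, Finset.prod_range_zero, pow_zero,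
      pow_one, RingAut.one_apply, one_mul, mul_one, map_one] at hk
    rw [hcomm]
    exact hα.mul_left_cancel (by rw [← hk, mul_comm])
  refine ⟨key, ?_⟩
  rw [← hord]
  exact pow_eq_pow_iff_modEq.mp (by rw [key, pow_one])
end

section
/- Let τ ∈ Aut(S) commute with σ and let α be a unit of S such that τ(a_i) = (∏_{l=i}^{m-1} σ^l(α))·b_i for all i ∈ {0, …, m−1}. Suppose there exists i_0 ∈ {0, …, m−1} such that N_{S/S_0}(τ(a_{i_0})) = N_{S/S_0}(b_{i_0}) is invertible in S, and that S_0 contains no nontrivial (m−i_0)-th root of unity. Then N_{S/S_0}(α) = 1. -/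
theorem Nsig_mul {S : Type*} [CommRing S] (σ : S ≃+* S) (n : ℕ) (x y : S) :
    Nsig σ n (x * y) = Nsig σ n x * Nsig σ n y := by
  simp [Nsig, Finset.prod_mul_distrib]

theorem Nsig_prod {S ι : Type*} [CommRing S] (σ : S ≃+* S) (n : ℕ) (s : Finset ι) (f : ι → S) :
    Nsig σ n (∏ l ∈ s, f l) = ∏ l ∈ s, Nsig σ n (f l) := by
  simp only [Nsig, map_prod]
  exact Finset.prod_comm

theorem map_Nsig {S : Type*} [CommRing S] (σ τ : S ≃+* S) (h : Commute σ τ) (n : ℕ) (x : S) :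
    τ (Nsig σ n x) = Nsig σ n (τ x) := by
  simp only [Nsig, map_prod]
  refine Finset.prod_congr rfl fun j _ => ?_
  exact congrArg (fun f : S ≃+* S => f x) (h.symm.pow_right j).eq

theorem Nsig_apply_self {S : Type*} [CommRing S] {σ : S ≃+* S} {n : ℕ} (hσ : σ ^ n = 1) (x : S) :
    Nsig σ n (σ x) = Nsig σ n x := by
  have h : ∀ j, (σ ^ j) (σ x) = (σ ^ (j + 1)) x := fun j => by rw [pow_succ]; rfl
  cases n with
  | zero => rfl
  | succ k =>
    simp only [Nsig, h]
    rw [Finset.prod_range_succ, Finset.prod_range_succ' (fun j => (σ ^ j) x), hσ, pow_zero]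

theorem Nsig_apply_pow {S : Type*} [CommRing S] {σ : S ≃+* S} {n : ℕ} (hσ : σ ^ n = 1) (l : ℕ)
    (x : S) : Nsig σ n ((σ ^ l) x) = Nsig σ n x := by
  induction l with
  | zero => rfl
  | succ k ih => rw [pow_succ', RingAut.mul_apply, Nsig_apply_self hσ, ih]

/-- **Proposition.**  Let `τ ∈ Aut(S)` commute with `σ` and let `α ∈ S^×` satisfy
`τ(a_i) = (∏_{l=i}^{m-1} σ^l(α))·b_i` for all `i ∈ {0,…,m−1}`.  Suppose there is an
`i₀` such that `N_{S/S₀}(τ(a_{i₀})) = N_{S/S₀}(b_{i₀})` is invertible and `S₀` contains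
no nontrivial `(m−i₀)`-th root of unity.  Then `N_{S/S₀}(α) = 1`
(here `N_{S/S₀} = N_n^σ`, `n` the order of `σ`). -/
theorem stmt11 {S : Type*} [CommRing S] (σ τ : S ≃+* S) (hστ : σ * τ = τ * σ)
    (n : ℕ) (hn : 0 < n) (hord : orderOf σ = n)
    (m : ℕ) (hm : 1 < m) (a b : Fin m → S) (α : S) (hα : IsUnit α)
    (heq : ∀ i : Fin m, τ (a i) = (∏ l ∈ Finset.Ico (i : ℕ) m, (σ ^ l) α) * b i)
    (i0 : Fin m)
    (h1 : Nsig σ n (τ (a i0)) = Nsig σ n (b i0))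
    (h2 : IsUnit (Nsig σ n (b i0)))
    (h3 : ∀ ζ : S, σ ζ = ζ → ζ ^ (m - (i0 : ℕ)) = 1 → ζ = 1) :
    Nsig σ n α = 1 := by
  have hσ : σ ^ n = 1 := hord ▸ pow_orderOf_eq_one σ
  refine h3 _ ((map_Nsig σ σ (Commute.refl σ) n α).trans (Nsig_apply_self hσ α)) ?_
  rw [heq, Nsig_mul, Nsig_prod] at h1
  simp only [Nsig_apply_pow hσ, Finset.prod_const, Nat.card_Ico] at h1
  exact h2.mul_eq_right.mp h1
end

section
/- Let g, h, h' be monic polynomials in S[t;σ,δ] with f = g·h = h'·g, where g is a monic right divisor of f. Let C be the skew (f,σ,δ)-polycyclic code corresponding to g, i.e. C consists of the coefficient vectors (c_0, …, c_{m-1}) of the elements of the principal left ideal generated by g in S_f. Then for c(t) = ∑_{i=0}^{m-1} c_i t^i the following are equivalent: (i) (c_0, …, c_{m-1}) ∈ C; (ii) c·h = 0 in S_f (i.e. the remainder of the product c(t)h(t) under right division by f in S[t;σ,δ] is zero); (iii) L_c(h) = c∘h = 0, equivalently R_h(c) = 0, in S_f. -/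
/-- Left multiplication by `t`, followed by reduction modulo `f = t^m − ∑ a_i t^i`, on
coefficient vectors representing elements of the Petit algebra `S[t;σ,δ]/S[t;σ,δ]f`. -/
def tmulD {S : Type*} [Ring S] (σ : S ≃+* S) (δ : S → S) {m : ℕ} (a : Fin m → S)
    (c : Fin m → S) : Fin m → S :=
  fun j =>
    (if _ : (j : ℕ) = 0 then 0 else σ (c ⟨(j : ℕ) - 1, by have := j.isLt; omega⟩)) + δ (c j) +
      σ (c ⟨m - 1, by have := j.isLt; omega⟩) * a j

/-- The multiplication of the Petit algebra `S_f = S[t;σ,δ]/S[t;σ,δ]f`,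
`f = t^m − ∑ a_i t^i`: `g ∘ h` is the remainder of `g·h` under right division by `f`. -/
def petitMulD {S : Type*} [Ring S] (σ : S ≃+* S) (δ : S → S) {m : ℕ} (a : Fin m → S)
    (g h : Fin m → S) : Fin m → S :=
  fun j => ∑ i : Fin m, g i * (tmulD σ δ a)^[(i : ℕ)] h j

/-- Left multiplication by `t` in `S[t;σ,δ]` on coefficient sequences:
`t·(∑ p_n t^n) = ∑ (σ(p_n) t^{n+1} + δ(p_n) t^n)`. -/
def tPolyMulD {S : Type*} [Ring S] (σ : S ≃+* S) (δ : S → S) (p : ℕ → S) : ℕ → S :=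
  fun n => (if _ : n = 0 then 0 else σ (p (n - 1))) + δ (p n)

/-- The product `g·h` in `S[t;σ,δ]` for a left factor `g` supported in degrees `< D`:
`g·h = ∑_{i<D} g_i (t^i·h)`. -/
def skewMulD {S : Type*} [Ring S] (σ : S ≃+* S) (δ : S → S) (D : ℕ) (g h : ℕ → S) : ℕ → S :=
  fun n => ∑ i ∈ Finset.range D, g i * (tPolyMulD σ δ)^[i] h n

/-- The remainder under right division by `f = t^m − ∑ a_i t^i` of a skew polynomial of
degree `< D` in `S[t;σ,δ]`, as a coefficient vector in `S^m`. -/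
def reduceD {S : Type*} [Ring S] (σ : S ≃+* S) (δ : S → S) {m : ℕ} (a : Fin m → S)
    (D : ℕ) (q : ℕ → S) : Fin m → S :=
  ∑ n ∈ Finset.range D, q n • (tmulD σ δ a)^[n] (stdVec m 0 1)

/-- An additive map `T` on an `S`-module with `T (s • x) = σ s • T x + δ s • x`. -/
structure IsPseudoLinear {S M : Type*} [CommRing S] [AddCommGroup M] [Module S M]
    (σ : S ≃+* S) (δ : S → S) (T : M → M) : Prop where
  map_add : ∀ x y, T (x + y) = T x + T y
  map_smul : ∀ (s : S) x, T (s • x) = σ s • T x + δ s • x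

/-- The action `∑_{n<D} q_n T^n v` of the skew polynomial `q` of degree `< D` on `v`. -/
def skewAct {S M : Type*} [CommRing S] [AddCommGroup M] [Module S M]
    (T : M → M) (D : ℕ) (q : ℕ → S) (v : M) : M :=
  ∑ n ∈ Finset.range D, q n • T^[n] v

/-- Extension of a coefficient vector by zero to a coefficient sequence. -/
def extendZero {S : Type*} [CommRing S] {m : ℕ} (c : Fin m → S) : ℕ → S :=
  fun n => if hn : n < m then c ⟨n, hn⟩ else 0

/-- The coefficient sequence of `t^m − ∑ a_i t^i`. -/
def modulusSeq {S : Type*} [CommRing S] {m : ℕ} (a : Fin m → S) : ℕ → S :=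
  fun n => if n = m then (1 : S) else if hn : n < m then -a ⟨n, hn⟩ else 0

section PseudoLinear

variable {S M N : Type*} [CommRing S] [AddCommGroup M] [Module S M] [AddCommGroup N] [Module S N]
  {σ : S ≃+* S} {δ : S → S} {T : M → M}

theorem skewDerivation_zero (hδadd : ∀ x y : S, δ (x + y) = δ x + δ y) : δ 0 = 0 := by
  simpa using hδadd 0 0

theorem skewDerivation_one (hδmul : ∀ x y : S, δ (x * y) = σ x * δ y + δ x * y) : δ 1 = 0 := by
  simpa using hδmul 1 1

theorem IsPseudoLinear.map_zero (hT : IsPseudoLinear σ δ T) : T 0 = 0 := by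
  simpa using hT.map_add 0 0

theorem IsPseudoLinear.map_sum (hT : IsPseudoLinear σ δ T) {ι : Type*} (s : Finset ι)
    (u : ι → M) : T (∑ i ∈ s, u i) = ∑ i ∈ s, T (u i) :=
  _root_.map_sum (AddMonoidHom.mk' T hT.map_add) u s

theorem isPseudoLinear_tPolyMulD (hδadd : ∀ x y : S, δ (x + y) = δ x + δ y)
    (hδmul : ∀ x y : S, δ (x * y) = σ x * δ y + δ x * y) :
    IsPseudoLinear σ δ (tPolyMulD σ δ) where
  map_add x y := by
    funext n
    by_cases hn : n = 0 <;> simp [tPolyMulD, hn, hδadd] <;> ring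
  map_smul s x := by
    funext n
    by_cases hn : n = 0 <;> simp [tPolyMulD, hn, hδmul] <;> ring

theorem isPseudoLinear_tmulD (hδadd : ∀ x y : S, δ (x + y) = δ x + δ y)
    (hδmul : ∀ x y : S, δ (x * y) = σ x * δ y + δ x * y) {m : ℕ} (a : Fin m → S) :
    IsPseudoLinear σ δ (tmulD σ δ a) where
  map_add x y := by
    funext j
    by_cases hj : (j : ℕ) = 0 <;> simp [tmulD, hj, hδadd] <;> ring
  map_smul s x := by
    funext j
    by_cases hj : (j : ℕ) = 0 <;> simp [tmulD, hj, hδmul] <;> ring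

theorem skewAct_of_le {D E : ℕ} {q : ℕ → S} (hq : ∀ n, D ≤ n → q n = 0) (hDE : D ≤ E) (v : M) :
    skewAct T E q v = skewAct T D q v := by
  refine (Finset.sum_subset (Finset.range_mono hDE) fun n _ hn => ?_).symm
  rw [hq n (by simpa using hn), zero_smul]

theorem skewAct_add (D : ℕ) (p q : ℕ → S) (v : M) :
    skewAct T D (p + q) v = skewAct T D p v + skewAct T D q v := by
  simp [skewAct, add_smul, Finset.sum_add_distrib]

theorem skewAct_smul (D : ℕ) (s : S) (q : ℕ → S) (v : M) :
    skewAct T D (s • q) v = s • skewAct T D q v := by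
  simp [skewAct, Finset.smul_sum, mul_smul]

theorem skewAct_sum {ι : Type*} (s : Finset ι) (D : ℕ) (q : ι → ℕ → S) (v : M) :
    skewAct T D (∑ i ∈ s, q i) v = ∑ i ∈ s, skewAct T D (q i) v := by
  simp only [skewAct, Finset.sum_apply, Finset.sum_smul]
  exact Finset.sum_comm

theorem skewAct_zero_right (hT : IsPseudoLinear σ δ T) (D : ℕ) (q : ℕ → S) :
    skewAct T D q (0 : M) = 0 := by
  simp [skewAct, Function.iterate_fixed hT.map_zero]

/-- An `S`-linear map intertwining `T` and `T'` intertwines the actions of skew polynomials. -/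
theorem map_skewAct {T' : N → N} (φ : M →ₗ[S] N) (hφ : ∀ v, φ (T v) = T' (φ v)) (D : ℕ)
    (q : ℕ → S) (v : M) : φ (skewAct T D q v) = skewAct T' D q (φ v) := by
  have hiter (n : ℕ) : φ (T^[n] v) = T'^[n] (φ v) :=
    (Function.Semiconj.iterate_right (f := φ) hφ n) v
  simp [skewAct, hiter]

theorem skewAct_tPolyMulD_succ (hδ0 : δ 0 = 0) (hT : IsPseudoLinear σ δ T) {D : ℕ} {q : ℕ → S}
    (hq : ∀ n, D ≤ n → q n = 0) (v : M) :
    skewAct T (D + 1) (tPolyMulD σ δ q) v = T (skewAct T D q v) := by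
  have h₁ : ∑ n ∈ Finset.range (D + 1), (if _ : n = 0 then 0 else σ (q (n - 1))) • T^[n] v =
      ∑ n ∈ Finset.range D, σ (q n) • T^[n + 1] v := by
    rw [Finset.sum_range_succ']
    simp
  have h₂ : ∑ n ∈ Finset.range (D + 1), δ (q n) • T^[n] v =
      ∑ n ∈ Finset.range D, δ (q n) • T^[n] v := by
    rw [Finset.sum_range_succ, hq D le_rfl, hδ0, zero_smul, add_zero]
  simp only [skewAct, tPolyMulD, add_smul, Finset.sum_add_distrib]
  rw [h₁, h₂, hT.map_sum, ← Finset.sum_add_distrib]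
  exact Finset.sum_congr rfl fun n _ => by rw [hT.map_smul, Function.iterate_succ_apply']

theorem tPolyMulD_eq_zero (hδ0 : δ 0 = 0) {d : ℕ} {q : ℕ → S} (hq : ∀ n, d ≤ n → q n = 0)
    (n : ℕ) (hn : d + 1 ≤ n) : tPolyMulD σ δ q n = 0 := by
  simp [tPolyMulD, hq n (by omega), hq (n - 1) (by omega), hδ0]

theorem tPolyMulD_iterate_eq_zero (hδ0 : δ 0 = 0) {d : ℕ} {q : ℕ → S}
    (hq : ∀ n, d ≤ n → q n = 0) (i : ℕ) :
    ∀ n, d + i ≤ n → (tPolyMulD σ δ)^[i] q n = 0 := by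
  induction i with
  | zero => exact hq
  | succ i ih =>
    intro n hn
    rw [Function.iterate_succ_apply']
    exact tPolyMulD_eq_zero hδ0 ih n hn

theorem tPolyMulD_iterate_leading (hδ0 : δ 0 = 0) {d : ℕ} {q : ℕ → S}
    (hq1 : q d = 1) (hq : ∀ n, d < n → q n = 0) (i : ℕ) :
    (tPolyMulD σ δ)^[i] q (d + i) = 1 := by
  induction i with
  | zero => exact hq1
  | succ i ih =>
    have hz := tPolyMulD_iterate_eq_zero (σ := σ) hδ0 (d := d + 1) hq i (d + (i + 1)) (by omega)
    rw [Function.iterate_succ_apply', tPolyMulD, hz, hδ0]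
    simp [← add_assoc, ih]

theorem skewAct_tPolyMulD_iterate (hδ0 : δ 0 = 0) (hT : IsPseudoLinear σ δ T) {d D : ℕ}
    {q : ℕ → S} (hq : ∀ n, d ≤ n → q n = 0) (v : M) (i : ℕ) (hi : d + i ≤ D) :
    skewAct T D ((tPolyMulD σ δ)^[i] q) v = T^[i] (skewAct T D q v) := by
  induction i with
  | zero => rfl
  | succ i ih =>
    have hz := tPolyMulD_iterate_eq_zero (σ := σ) hδ0 hq i
    rw [Function.iterate_succ_apply', Function.iterate_succ_apply', ← ih (by omega),
      skewAct_of_le (D := d + i + 1) (tPolyMulD_eq_zero hδ0 hz) hi,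
      skewAct_tPolyMulD_succ hδ0 hT hz, skewAct_of_le (E := D) hz (by omega)]

/-- The action of a product is the composition of the actions. -/
theorem skewAct_skewMulD (hδ0 : δ 0 = 0) (hT : IsPseudoLinear σ δ T) {d D k : ℕ} (p : ℕ → S)
    {q : ℕ → S} (hq : ∀ n, d ≤ n → q n = 0) (hD : d + k ≤ D + 1) (v : M) :
    skewAct T D (skewMulD σ δ k p q) v = skewAct T k p (skewAct T D q v) := by
  have hmul : skewMulD σ δ k p q = ∑ i ∈ Finset.range k, p i • (tPolyMulD σ δ)^[i] q := by
    funext n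
    simp [skewMulD]
  rw [hmul, skewAct_sum]
  refine Finset.sum_congr rfl fun i hi => ?_
  have hik := Finset.mem_range.mp hi
  rw [skewAct_smul, skewAct_tPolyMulD_iterate hδ0 hT hq v i (by omega)]

theorem skewMulD_eq_zero (hδ0 : δ 0 = 0) {d k : ℕ} (p : ℕ → S) {q : ℕ → S}
    (hq : ∀ n, d < n → q n = 0) (n : ℕ) (hn : d + k ≤ n) : skewMulD σ δ k p q n = 0 := by
  refine Finset.sum_eq_zero fun i hi => ?_
  have hik := Finset.mem_range.mp hi
  rw [tPolyMulD_iterate_eq_zero (d := d + 1) hδ0 hq i n (by omega), mul_zero]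

/-- A monic skew polynomial is right cancellable. -/
theorem eq_zero_of_skewMulD_eq_zero (hδ0 : δ 0 = 0) {d : ℕ} {q : ℕ → S} (hq1 : q d = 1)
    (hq : ∀ n, d < n → q n = 0) (p : ℕ → S) (k : ℕ) (hpq : skewMulD σ δ k p q = 0) :
    ∀ n < k, p n = 0 := by
  induction k with
  | zero => simp
  | succ k ih =>
    have hsucc (n : ℕ) : skewMulD σ δ (k + 1) p q n =
        skewMulD σ δ k p q n + p k * (tPolyMulD σ δ)^[k] q n := Finset.sum_range_succ _ _
    have hk : p k = 0 := by
      have := hsucc (d + k)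
      rw [hpq, skewMulD_eq_zero hδ0 p hq _ le_rfl,
        tPolyMulD_iterate_leading hδ0 hq1 hq k] at this
      simpa using this.symm
    have hlow : skewMulD σ δ k p q = 0 := by
      funext n
      have := hsucc n
      rw [hpq, hk] at this
      simpa using this.symm
    intro n hn
    rcases Nat.lt_succ_iff_lt_or_eq.mp hn with h | rfl
    · exact ih hlow n h
    · exact hk

/-- Right division with remainder by a monic skew polynomial. -/
theorem exists_skewMulD_add (hδ0 : δ 0 = 0) {r : ℕ} {g : ℕ → S} (hg1 : g r = 1)
    (hg : ∀ n, r < n → g n = 0) (k : ℕ) :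
    ∀ p : ℕ → S, (∀ n, k + r ≤ n → p n = 0) →
      ∃ x s : ℕ → S, (∀ n, r ≤ n → s n = 0) ∧ p = skewMulD σ δ k x g + s := by
  induction k with
  | zero =>
    intro p hp
    exact ⟨0, p, by simpa using hp, by funext n; simp [skewMulD]⟩
  | succ k ih =>
    intro p hp
    obtain ⟨x, s, hs, hx⟩ := ih (p - p (r + k) • (tPolyMulD σ δ)^[k] g) fun n hn => by
      rcases (show r + k ≤ n by omega).eq_or_lt with rfl | hlt
      · simp [tPolyMulD_iterate_leading hδ0 hg1 hg k]
      · simp [hp n (by omega),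
          tPolyMulD_iterate_eq_zero (d := r + 1) (σ := σ) hδ0 hg k n (by omega)]
    refine ⟨Function.update x k (p (r + k)), s, hs, ?_⟩
    funext n
    have hlow : skewMulD σ δ k (Function.update x k (p (r + k))) g n = skewMulD σ δ k x g n :=
      Finset.sum_congr rfl fun i hi => by
        rw [Function.update_of_ne (Finset.mem_range.mp hi).ne]
    have hsucc : skewMulD σ δ (k + 1) (Function.update x k (p (r + k))) g n =
        skewMulD σ δ k x g n + p (r + k) * (tPolyMulD σ δ)^[k] g n := by
      rw [← hlow]
      simp [skewMulD, Finset.sum_range_succ]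
    have hn := congrFun hx n
    simp only [Pi.sub_apply, Pi.smul_apply, smul_eq_mul, Pi.add_apply] at hn ⊢
    rw [hsucc]
    linear_combination hn

end PseudoLinear

section PetitAlgebra

variable {S M : Type*} [CommRing S] [AddCommGroup M] [Module S M]
  {σ : S ≃+* S} {δ : S → S} {m : ℕ}

theorem extendZero_eq_zero (c : Fin m → S) (n : ℕ) (hn : m ≤ n) : extendZero c n = 0 :=
  dif_neg (by omega)

theorem extendZero_coe (c : Fin m → S) (j : Fin m) : extendZero c j = c j := by
  simp [extendZero]

theorem reduceD_eq_skewAct (a : Fin m → S) (D : ℕ) (q : ℕ → S) :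
    reduceD σ δ a D q = skewAct (tmulD σ δ a) D q (stdVec m 0 1) := rfl

theorem petitMulD_eq_skewAct (a c w : Fin m → S) :
    petitMulD σ δ a c w = skewAct (tmulD σ δ a) m (extendZero c) w := by
  funext j
  simp [petitMulD, skewAct, Finset.sum_range, extendZero_coe]

theorem tmulD_iterate_stdVec (hδ0 : δ 0 = 0) (hδ1 : δ 1 = 0) (a : Fin m → S) (n : ℕ)
    (hn : n < m) : (tmulD σ δ a)^[n] (stdVec m 0 1) = stdVec m n 1 := by
  induction n with
  | zero => rfl
  | succ n ih =>
    rw [Function.iterate_succ_apply', ih (by omega)]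
    funext j
    have hδ (k : ℕ) : δ (if (j : ℕ) = k then 1 else 0) = 0 := by split_ifs <;> assumption
    by_cases hj : (j : ℕ) = 0
    · simp [tmulD, stdVec, hj, show ¬ m - 1 = n by omega]
      split_ifs <;> assumption
    · simp [tmulD, stdVec, hj, hδ, show ¬ m - 1 = n by omega,
        show (j : ℕ) - 1 = n ↔ (j : ℕ) = n + 1 by omega]

theorem tmulD_iterate_stdVec_self (hδ0 : δ 0 = 0) (hδ1 : δ 1 = 0) (hm : 0 < m)
    (a : Fin m → S) : (tmulD σ δ a)^[m] (stdVec m 0 1) = a := by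
  obtain ⟨k, rfl⟩ : ∃ k, m = k + 1 := ⟨m - 1, by omega⟩
  rw [Function.iterate_succ_apply', tmulD_iterate_stdVec hδ0 hδ1 a k (by omega)]
  funext j
  have hδ (i : ℕ) : δ (if (j : ℕ) = i then 1 else 0) = 0 := by split_ifs <;> assumption
  have := j.isLt
  by_cases hj : (j : ℕ) = 0
  · simp [tmulD, stdVec, hj]
    split_ifs <;> assumption
  · simp [tmulD, stdVec, hδ, show ¬ (j : ℕ) - 1 = k by omega]

/-- Reduction modulo `f` is truncation in degrees below `m`. -/
theorem skewAct_stdVec (hδ0 : δ 0 = 0) (hδ1 : δ 1 = 0) (a : Fin m → S) {D : ℕ} (hD : m ≤ D)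
    {q : ℕ → S} (hq : ∀ n, m ≤ n → q n = 0) :
    skewAct (tmulD σ δ a) D q (stdVec m 0 1) = fun j : Fin m => q j := by
  rw [skewAct_of_le hq hD, skewAct, Finset.sum_congr rfl fun n hn => by
    rw [tmulD_iterate_stdVec hδ0 hδ1 a n (Finset.mem_range.mp hn)]]
  funext j
  simp [stdVec]

theorem skewAct_modulusSeq {T : M → M} (a : Fin m → S) (v : M) :
    skewAct T (m + 1) (modulusSeq a) v = T^[m] v - skewAct T m (extendZero a) v := by
  rw [skewAct, Finset.sum_range_succ, skewAct, Finset.sum_congr rfl fun n hn => by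
    rw [show modulusSeq a n = -extendZero a n by
      have := Finset.mem_range.mp hn
      simp [modulusSeq, extendZero, this, this.ne], neg_smul]]
  simp only [Finset.sum_neg_distrib, modulusSeq, if_true, one_smul]
  abel

theorem skewAct_modulusSeq_stdVec (hδ0 : δ 0 = 0) (hδ1 : δ 1 = 0) (hm : 0 < m)
    (a : Fin m → S) : skewAct (tmulD σ δ a) (m + 1) (modulusSeq a) (stdVec m 0 1) = 0 := by
  rw [skewAct_modulusSeq, tmulD_iterate_stdVec_self hδ0 hδ1 hm,
    skewAct_stdVec hδ0 hδ1 a le_rfl (extendZero_eq_zero a)]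
  simp [extendZero_coe]

/-- If `f` annihilates `w`, then the action on `w` factors through `S_f`. -/
theorem skewAct_extendZero_tmulD (hδ0 : δ 0 = 0) {T : M → M} (hT : IsPseudoLinear σ δ T)
    (hm : 0 < m) (a : Fin m → S) {w : M} (hw : skewAct T (m + 1) (modulusSeq a) w = 0)
    (v : Fin m → S) :
    skewAct T m (extendZero (tmulD σ δ a v)) w = T (skewAct T m (extendZero v) w) := by
  rw [skewAct_modulusSeq, sub_eq_zero] at hw
  rw [← skewAct_tPolyMulD_succ hδ0 hT (extendZero_eq_zero v), skewAct, skewAct,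
    Finset.sum_range_succ, hw]
  have htop : tPolyMulD σ δ (extendZero v) m = σ (v ⟨m - 1, by omega⟩) := by
    simp [tPolyMulD, extendZero, hδ0, hm, hm.ne']
  rw [htop, skewAct, Finset.smul_sum, ← Finset.sum_add_distrib]
  refine Finset.sum_congr rfl fun n hn => ?_
  have hn' := Finset.mem_range.mp hn
  rw [smul_smul, ← add_smul]
  congr 1
  simp [extendZero, tmulD, tPolyMulD, hn', show n - 1 < m by omega]

end PetitAlgebra

/-- **Theorem (parity check for skew polycyclic codes).**  Let `g, h, h'` be monic in
`S[t;σ,δ]` with `f = g·h = h'·g`, `g` of degree `r ≥ 1` a right divisor of the monic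
degree-`m` polynomial `f = t^m − ∑ a_i t^i`.  Let `C` be the skew `(f,σ,δ)`-polycyclic
code corresponding to `g`, i.e. the set of coefficient vectors of elements of the
principal left ideal generated by `g` in `S_f`.  Then for `c = ∑ c_i t^i` the following
are equivalent: (i) `c ∈ C`; (ii) the remainder of `c(t)·h(t)` under right division by
`f` is zero; (iii) `c ∘ h = 0` in `S_f` (i.e. `L_c(h) = 0`, equivalently `R_h(c) = 0`). -/
theorem stmt17 {S : Type*} [CommRing S] (σ : S ≃+* S) (δ : S → S)
    (hδadd : ∀ x y : S, δ (x + y) = δ x + δ y)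
    (hδmul : ∀ x y : S, δ (x * y) = σ x * δ y + δ x * y)
    (m : ℕ) (hm : 1 < m) (a : Fin m → S)
    (g h h' : ℕ → S) (r : ℕ) (hr : 1 ≤ r) (hrm : r ≤ m)
    (hgmon : g r = 1 ∧ ∀ n, r < n → g n = 0)
    (hhmon : h (m - r) = 1 ∧ ∀ n, m - r < n → h n = 0)
    (hh'mon : h' (m - r) = 1 ∧ ∀ n, m - r < n → h' n = 0)
    (hfgh : (fun n => if n = m then (1 : S) else if hn : n < m then -a ⟨n, hn⟩ else 0)
      = skewMulD σ δ (r + 1) g h)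
    (hfh'g : (fun n => if n = m then (1 : S) else if hn : n < m then -a ⟨n, hn⟩ else 0)
      = skewMulD σ δ (m - r + 1) h' g)
    (c : Fin m → S) :
    ((∃ x : Fin m → S,
        c = reduceD σ δ a (2 * m)
          (skewMulD σ δ m (fun n => if hn : n < m then x ⟨n, hn⟩ else 0) g)) ↔
      reduceD σ δ a (2 * m)
        (skewMulD σ δ m (fun n => if hn : n < m then c ⟨n, hn⟩ else 0) h) = 0) ∧
    (reduceD σ δ a (2 * m)
        (skewMulD σ δ m (fun n => if hn : n < m then c ⟨n, hn⟩ else 0) h) = 0 ↔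
      petitMulD σ δ a c (fun j => h (j : ℕ)) = 0) := by
  have hδ0 := skewDerivation_zero hδadd
  have hδ1 := skewDerivation_one hδmul
  have hT := isPseudoLinear_tmulD hδadd hδmul a
  have hg : ∀ n, r + 1 ≤ n → g n = 0 := hgmon.2
  have hh : ∀ n, m - r + 1 ≤ n → h n = 0 := hhmon.2
  change modulusSeq a = _ at hfgh hfh'g
  set T := tmulD σ δ a with hTdef
  set w : Fin m → S := fun j => h j with hwdef
  have hred_h (D : ℕ) (hD : m ≤ D) : skewAct T D h (stdVec m 0 1) = w :=
    skewAct_stdVec hδ0 hδ1 a hD fun n hn => hh n (by omega)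
  have hgw : skewAct T (r + 1) g w = 0 := by
    rw [← hred_h (m + 1) (by omega), ← skewAct_skewMulD hδ0 hT g hh (by omega), ← hfgh]
    exact skewAct_modulusSeq_stdVec hδ0 hδ1 (by omega) a
  have hgwD (D : ℕ) (hD : r + 1 ≤ D) : skewAct T D g w = 0 := by
    rw [skewAct_of_le hg hD, hgw]
  have hfw : skewAct T (m + 1) (modulusSeq a) w = 0 := by
    rw [hfh'g, skewAct_skewMulD hδ0 hT h' hg (by omega), hgwD _ (by omega),
      skewAct_zero_right hT]
  have hred_mul (q : ℕ → S) : reduceD σ δ a (2 * m) (skewMulD σ δ m q h) = skewAct T m q w := by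
    rw [reduceD_eq_skewAct, skewAct_skewMulD hδ0 hT q hh (by omega), hred_h _ (by omega)]
  change ((∃ x : Fin m → S, c = reduceD σ δ a (2 * m) (skewMulD σ δ m (extendZero x) g)) ↔
      reduceD σ δ a (2 * m) (skewMulD σ δ m (extendZero c) h) = 0) ∧
    (reduceD σ δ a (2 * m) (skewMulD σ δ m (extendZero c) h) = 0 ↔ petitMulD σ δ a c w = 0)
  rw [hred_mul, petitMulD_eq_skewAct]
  refine ⟨⟨?_, fun hc => ?_⟩, Iff.rfl⟩
  · rintro ⟨x, hx⟩
    let R : (Fin m → S) →ₗ[S] (Fin m → S) :=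
      { toFun := fun v => skewAct T m (extendZero v) w
        map_add' := fun u v => by
          simp only [← petitMulD_eq_skewAct, T]
          funext j
          simp [petitMulD, add_mul, Finset.sum_add_distrib]
        map_smul' := fun s v => by
          simp only [← petitMulD_eq_skewAct, T]
          funext j
          simp [petitMulD, mul_assoc, Finset.mul_sum] }
    have hR (v : Fin m → S) : R (T v) = T (R v) :=
      skewAct_extendZero_tmulD hδ0 hT (by omega) a hfw v
    have hR1 : R (stdVec m 0 1) = w := by
      change skewAct T m (extendZero (stdVec m 0 1)) w = w
      rw [skewAct_of_le (D := 1) (fun n hn => ?_) (by omega)]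
      · simp [skewAct, extendZero, stdVec, show 0 < m by omega]
      · simp [extendZero, stdVec, show n ≠ 0 by omega]
    change R c = 0
    rw [hx, reduceD_eq_skewAct, skewAct_skewMulD hδ0 hT _ hg (by omega),
      map_skewAct R hR, map_skewAct R hR, hR1, hgwD _ (by omega), skewAct_zero_right hT]
  · obtain ⟨x, s, hs, hxs⟩ := exists_skewMulD_add (σ := σ) hδ0 hgmon.1 hgmon.2 m (extendZero c)
      fun n hn => extendZero_eq_zero c n (by omega)
    have hsw : skewAct T r s w = 0 := by
      have hsplit : skewAct T (2 * m) (extendZero c) w = 0 := by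
        rw [skewAct_of_le (extendZero_eq_zero c) (by omega), hc]
      rwa [hxs, skewAct_add, skewAct_skewMulD hδ0 hT x hg (by omega), hgwD _ (by omega),
        skewAct_zero_right hT, zero_add, skewAct_of_le hs (by omega)] at hsplit
    have hsh0 : ∀ n, m ≤ n → skewMulD σ δ r s h n = 0 := fun n hn =>
      skewMulD_eq_zero hδ0 s hhmon.2 n (by omega)
    have hsh : skewMulD σ δ r s h = 0 := by
      rw [← hred_h m le_rfl, ← skewAct_skewMulD hδ0 hT s hh (by omega),
        skewAct_stdVec hδ0 hδ1 a le_rfl hsh0] at hsw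
      funext n
      rcases lt_or_ge n m with hn | hn
      · exact congrFun hsw ⟨n, hn⟩
      · exact hsh0 n hn
    have hs0 : s = 0 := by
      funext n
      rcases lt_or_ge n r with hn | hn
      · exact eq_zero_of_skewMulD_eq_zero hδ0 hhmon.1 hhmon.2 s r hsh n hn
      · exact hs n hn
    have hmul : skewMulD σ δ m (extendZero fun j : Fin m => x j) g = extendZero c := by
      rw [hxs, hs0, add_zero]
      funext n
      refine Finset.sum_congr rfl fun i hi => ?_
      rw [extendZero, dif_pos (Finset.mem_range.mp hi)]
    refine ⟨fun j => x j, ?_⟩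
    rw [hmul, reduceD_eq_skewAct, skewAct_stdVec hδ0 hδ1 a (by omega) (extendZero_eq_zero c)]
    simp [extendZero_coe]
end
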